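/- Let A be the complex 4×4 matrix A = (1/2) · [[1, 1, 1, 1], [−i, i, −i, i], [−i, −i, i, i], [−1, 1, 1, −1]]. Then A is invertible, and for all real numbers θ and m: A · diag( e^{i(m+1)θ}, e^{i(m−1)θ}, e^{−i(m−1)θ}, e^{−i(m+1)θ} ) = ( L ⊗ R ) · A, where L = [[cos(mθ), −sin(mθ)], [sin(mθ), cos(mθ)]] and R = [[cos(θ), −sin(θ)], [sin(θ), cos(θ)]] are rotation matrices regarded as complex 2×2 matrices, and L ⊗ R denotes their Kronecker product (the 4×4 matrix with 2×2 blocks L_{jk} · R). -/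

import Mathlib

open Matrix Kronecker Complex

/-- The matrix `A = (1/2)·[[1,1,1,1],[−i,i,−i,i],[−i,−i,i,i],[−1,1,1,−1]]`. -/
noncomputable def matA : Matrix (Fin 4) (Fin 4) ℂ :=
  (1/2 : ℂ) • !![1, 1, 1, 1;
                 -Complex.I, Complex.I, -Complex.I, Complex.I;
                 -Complex.I, -Complex.I, Complex.I, Complex.I;
                 -1, 1, 1, -1]

/-- The rotation matrix of angle `x`, regarded as a complex `2×2` matrix. -/
noncomputable def rotMat (x : ℝ) : Matrix (Fin 2) (Fin 2) ℂ :=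
  !![(Real.cos x : ℂ), -(Real.sin x : ℂ);
     (Real.sin x : ℂ), (Real.cos x : ℂ)]

/-- `A` is invertible, and conjugating the diagonal matrix
`diag(e^{i(m+1)θ}, e^{i(m−1)θ}, e^{−i(m−1)θ}, e^{−i(m+1)θ})` by `A` yields the Kronecker
product `L ⊗ R` of the rotation matrices of angles `mθ` and `θ`. -/
theorem matA_conjugation : IsUnit matA ∧
    ∀ (θ m : ℝ),
      matA * Matrix.diagonal
          ![Complex.exp (Complex.I * (((m + 1) * θ : ℝ) : ℂ)),
            Complex.exp (Complex.I * (((m - 1) * θ : ℝ) : ℂ)),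
            Complex.exp (-(Complex.I * (((m - 1) * θ : ℝ) : ℂ))),
            Complex.exp (-(Complex.I * (((m + 1) * θ : ℝ) : ℂ)))]
        = (Matrix.reindex finProdFinEquiv finProdFinEquiv (rotMat (m * θ) ⊗ₖ rotMat θ))
            * matA := by
  constructor
  · refine (isUnit_iff_exists_inv).2 ⟨(1/2 : ℂ) • !![1, I, I, -1;
                 1, -I, I, 1;
                 1, I, -I, 1;
                 1, -I, -I, -1], ?_⟩
    ext i j
    fin_cases i <;> fin_cases j <;>
      simp [matA, Matrix.mul_apply, Fin.sum_univ_four] <;>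
      ring_nf <;> simp [I_sq] <;> norm_num
  · intro θ m
    have key : ∀ x : ℝ, Complex.exp (I * (x : ℂ)) = (Real.cos x : ℂ) + (Real.sin x : ℂ) * I := by
      intro x
      rw [mul_comm, Complex.exp_mul_I, Complex.ofReal_cos, Complex.ofReal_sin]
    have key' : ∀ x : ℝ, Complex.exp (-(I * (x : ℂ)))
        = (Real.cos x : ℂ) - (Real.sin x : ℂ) * I := by
      intro x
      have h := key (-x)
      rw [Real.cos_neg, Real.sin_neg] at h
      push_cast at h ⊢
      rw [← mul_neg, h]
      ring
    have hK : Matrix.reindex finProdFinEquiv finProdFinEquiv (rotMat (m * θ) ⊗ₖ rotMat θ)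
        = Matrix.of (fun i j : Fin 4 =>
          rotMat (m * θ) (![0, 0, 1, 1] i) (![0, 0, 1, 1] j)
            * rotMat θ (![0, 1, 0, 1] i) (![0, 1, 0, 1] j)) := by
      ext i j
      fin_cases i <;> fin_cases j <;> rfl
    have e1 : (m + 1) * θ = m * θ + θ := by ring
    have e2 : (m - 1) * θ = m * θ - θ := by ring
    rw [hK, key, key, key', key', e1, e2, Real.cos_add, Real.sin_add, Real.cos_sub, Real.sin_sub]
    generalize hx : m * θ = x
    have hI : I ^ 2 = -1 := I_sq
    ext i j
    rw [Matrix.mul_diagonal, Matrix.mul_apply, Fin.sum_univ_four]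
    simp only [rotMat, matA]
    push_cast
    generalize Complex.cos (x : ℂ) = a
    generalize Complex.sin (x : ℂ) = b
    generalize Complex.cos (θ : ℂ) = c
    generalize Complex.sin (θ : ℂ) = d
    fin_cases i <;> fin_cases j <;> simp <;> grind
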